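/- Suppose g satisfies the r-th order Hölderian error bound with r > 1. Run the AGM-BiO iteration for T iterations with step sizes a_k = γ(k+1)/(4 L_f) where γ = 1/( (2 L_g / L_f) T^{(2r−2)/(2r−1)} + 2 ). Then the output x_T satisfies g(x_T) − g(x*) ≤ max{ 2 C_g (ln T + 1) / T^{2r/(2r−1)} + 2 C_f / T² , (2C)^{r/(r−1)} / T^{2r/(2r−1)} }, where C_f = 8 L_f ‖x_0 − x*‖², C_g = 12 L_g ‖x_0 − x*‖², C = M (r/α)^{1/r}, and M = max_{x ∈ X_g*} ‖∇f(x)‖. -/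

import Mathlib

open RealInnerProductSpace

section GradientInequalities

variable {E : Type*} [NormedAddCommGroup E] [InnerProductSpace ℝ E] [CompleteSpace E]

lemma HasGradientAt.hasDerivAt_comp_add_smul {f : E → ℝ} {v u d : E} {t : ℝ}
    (hf : HasGradientAt f v (u + t • d)) :
    HasDerivAt (fun s : ℝ => f (u + s • d)) ⟪v, d⟫ t := by
  have hline : HasDerivAt (fun s : ℝ => u + s • d) d t := by
    simpa using ((hasDerivAt_id t).smul_const d).const_add u
  exact hf.hasFDerivAt.comp_hasDerivAt t hline

lemma ConvexOn.add_inner_gradient_le {f : E → ℝ} {v u : E} (hconv : ConvexOn ℝ Set.univ f)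
    (hf : HasGradientAt f v u) (w : E) : f u + ⟪v, w - u⟫ ≤ f w := by
  have hder : HasDerivAt (fun s : ℝ => f (u + s • (w - u))) ⟪v, w - u⟫ 0 :=
    HasGradientAt.hasDerivAt_comp_add_smul (by simpa using hf)
  have hline : ConvexOn ℝ Set.univ (fun s : ℝ => f (u + s • (w - u))) := by
    have h := hconv.comp_affineMap (AffineMap.lineMap u w : ℝ →ᵃ[ℝ] E)
    refine ⟨convex_univ, fun p _ q _ a b ha hb hab => ?_⟩
    simpa [AffineMap.lineMap_apply, add_comm] using
      h.2 (Set.mem_univ p) (Set.mem_univ q) ha hb hab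
  have hslope := hline.le_slope_of_hasDerivAt (Set.mem_univ 0) (Set.mem_univ 1) one_pos hder
  simp only [slope_def_field, one_smul, zero_smul, add_sub_cancel, add_zero, sub_zero,
    div_one] at hslope
  linarith

lemma le_add_inner_gradient_add_of_lipschitz {f : E → ℝ} {f' : E → E} {L : ℝ}
    (hf : ∀ w, HasGradientAt f (f' w) w) (hLip : ∀ u v, ‖f' u - f' v‖ ≤ L * ‖u - v‖) (u w : E) :
    f w ≤ f u + ⟪f' u, w - u⟫ + L / 2 * ‖w - u‖ ^ 2 := by
  set d := w - u with hd
  have hder : ∀ t : ℝ, HasDerivAt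
      (fun s : ℝ => f (u + s • d) - s * ⟪f' u, d⟫ - L / 2 * ‖d‖ ^ 2 * s ^ 2)
      (⟪f' (u + t • d), d⟫ - ⟪f' u, d⟫ - L * ‖d‖ ^ 2 * t) t := by
    intro t
    have h := (((hf (u + t • d)).hasDerivAt_comp_add_smul).sub
      ((hasDerivAt_id t).mul_const ⟪f' u, d⟫)).sub
      (((hasDerivAt_id t).pow 2).const_mul (L / 2 * ‖d‖ ^ 2))
    refine h.congr_deriv ?_
    simp
    ring
  have hanti : AntitoneOn
      (fun s : ℝ => f (u + s • d) - s * ⟪f' u, d⟫ - L / 2 * ‖d‖ ^ 2 * s ^ 2) (Set.Icc 0 1) := by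
    refine antitoneOn_of_hasDerivWithinAt_nonpos (convex_Icc 0 1)
      (fun t _ => (hder t).continuousAt.continuousWithinAt)
      (fun t _ => (hder t).hasDerivWithinAt) fun t ht => ?_
    rw [interior_Icc] at ht
    have hinner : ⟪f' (u + t • d) - f' u, d⟫ ≤ L * ‖d‖ ^ 2 * t := calc
      _ ≤ ‖f' (u + t • d) - f' u‖ * ‖d‖ := real_inner_le_norm _ _
      _ ≤ L * ‖u + t • d - u‖ * ‖d‖ := by gcongr; exact hLip _ _
      _ = L * ‖d‖ ^ 2 * t := by
        rw [add_sub_cancel_left, norm_smul, Real.norm_of_nonneg ht.1.le]; ring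
    rw [inner_sub_left] at hinner
    linarith
  have h := hanti (Set.left_mem_Icc.2 zero_le_one) (Set.right_mem_Icc.2 zero_le_one) zero_le_one
  simp only [one_smul, zero_smul, add_zero, hd, add_sub_cancel] at h
  linarith

/-- One step of the accelerated gradient scheme for a smooth convex function. -/
lemma accelerated_step_le {f : E → ℝ} {f' : E → E} {L A a : ℝ} {x z z₁ y x₁ : E}
    (hconv : ConvexOn ℝ Set.univ f) (hf : ∀ w, HasGradientAt f (f' w) w)
    (hLip : ∀ u v, ‖f' u - f' v‖ ≤ L * ‖u - v‖) (hA : 0 ≤ A) (ha : 0 < a)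
    (hy : y = (A / (A + a)) • x + (a / (A + a)) • z)
    (hx₁ : x₁ = (A / (A + a)) • x + (a / (A + a)) • z₁) :
    (A + a) * f x₁ ≤ A * f x + a * (f y + ⟪f' y, z₁ - y⟫) +
      L * a ^ 2 / (2 * (A + a)) * ‖z₁ - z‖ ^ 2 := by
  have hpos : 0 < A + a := by positivity
  have hsub : x₁ - y = (a / (A + a)) • (z₁ - z) := by rw [hx₁, hy]; module
  have hcomb : (A + a) • (x₁ - y) = A • (x - y) + a • (z₁ - y) := by
    have h₁ : (A + a) • x₁ = A • x + a • z₁ := by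
      rw [hx₁, smul_add, smul_smul, smul_smul, mul_div_cancel₀ _ hpos.ne',
        mul_div_cancel₀ _ hpos.ne']
    rw [smul_sub, h₁]; module
  have hinner : (A + a) * ⟪f' y, x₁ - y⟫ = A * ⟪f' y, x - y⟫ + a * ⟪f' y, z₁ - y⟫ := by
    rw [← real_inner_smul_right, hcomb, inner_add_right, real_inner_smul_right,
      real_inner_smul_right]
  have hnorm : (A + a) * (L / 2 * ‖x₁ - y‖ ^ 2) =
      L * a ^ 2 / (2 * (A + a)) * ‖z₁ - z‖ ^ 2 := by
    rw [hsub, norm_smul, Real.norm_of_nonneg (by positivity)]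
    field_simp
  have hdesc := mul_le_mul_of_nonneg_left
    (le_add_inner_gradient_add_of_lipschitz hf hLip y x₁) hpos.le
  have hgrad := mul_le_mul_of_nonneg_left (hconv.add_inner_gradient_le (hf y) x) hA
  linarith

lemma ConvexOn.sub_mul_infDist_le [ProperSpace E] {f : E → ℝ} {f' : E → E} {S : Set E} {c M : ℝ}
    (hconv : ConvexOn ℝ Set.univ f) (hf : ∀ w, HasGradientAt f (f' w) w) (hS : IsClosed S)
    (hne : S.Nonempty) (hc : ∀ w ∈ S, c ≤ f w) (hM : ∀ w ∈ S, ‖f' w‖ ≤ M) (x : E) :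
    c - M * Metric.infDist x S ≤ f x := by
  obtain ⟨p, hp, hdist⟩ := hS.exists_infDist_eq_dist hne x
  have hgrad := hconv.add_inner_gradient_le (hf p) x
  have hcs := (abs_le.1 (abs_real_inner_le_norm (f' p) (x - p))).1
  have hbound : ‖f' p‖ * ‖x - p‖ ≤ M * ‖x - p‖ := by gcongr; exact hM p hp
  rw [hdist, dist_eq_norm]
  linarith [hc p hp]

end GradientInequalities

/-- The three-point inequality for a projected gradient step. -/
lemma two_mul_inner_le_of_projection {E : Type*} [NormedAddCommGroup E] [InnerProductSpace ℝ E]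
    {K : Set E} (hK : Convex ℝ K) {z z₁ v w : E} {a : ℝ} (hz₁ : z₁ ∈ K)
    (hproj : ∀ u ∈ K, ‖z₁ - (z - a • v)‖ ≤ ‖u - (z - a • v)‖) (hw : w ∈ K) :
    2 * (a * ⟪v, z₁ - w⟫) ≤ ‖z - w‖ ^ 2 - ‖z₁ - w‖ ^ 2 - ‖z₁ - z‖ ^ 2 := by
  have : Nonempty K := ⟨⟨z₁, hz₁⟩⟩
  have hmin : ‖(z - a • v) - z₁‖ = ⨅ u : K, ‖(z - a • v) - u‖ := by
    refine le_antisymm (le_ciInf fun u => ?_)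
      (ciInf_le ⟨0, Set.forall_mem_range.2 fun _ => norm_nonneg _⟩ (⟨z₁, hz₁⟩ : K))
    rw [norm_sub_rev, norm_sub_rev _ (u : E)]
    exact hproj u u.2
  have hvar := (norm_eq_iInf_iff_real_inner_le_zero hK hz₁).1 hmin w hw
  have hsplit : ⟪(z - a • v) - z₁, w - z₁⟫ = a * ⟪v, z₁ - w⟫ - ⟪z₁ - z, w - z₁⟫ := by
    rw [show (z - a • v) - z₁ = -(a • v) - (z₁ - z) by abel, inner_sub_left, inner_neg_left,
      real_inner_smul_left, ← neg_sub z₁ w, inner_neg_right, inner_neg_right]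
    ring
  have hsq : ‖z - w‖ ^ 2 = ‖z₁ - z‖ ^ 2 + 2 * ⟪z₁ - z, w - z₁⟫ + ‖z₁ - w‖ ^ 2 := by
    rw [norm_sub_rev z w, norm_sub_rev z₁ w, ← norm_add_sq_real]
    congr 2; abel
  linarith

lemma sum_range_inv_succ_le_log_add_one (n : ℕ) :
    ∑ i ∈ Finset.range n, ((i : ℝ) + 1)⁻¹ ≤ Real.log n + 1 := by
  have h := harmonic_le_one_add_log n
  simp only [harmonic, Rat.cast_sum, Rat.cast_inv] at h
  push_cast at h
  linarith

lemma le_max_two_mul_rpow_of_le_mul_rpow_add {h c e r : ℝ} (hh : 0 ≤ h) (hc : 0 ≤ c) (hr : 1 < r)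
    (hle : h ≤ c * h ^ (1 / r) + e) : h ≤ max (2 * e) ((2 * c) ^ (r / (r - 1))) := by
  by_cases he : h ≤ 2 * e
  · exact le_max_of_le_left he
  refine le_max_of_le_right ?_
  rcases hh.eq_or_lt with rfl | hpos
  · positivity
  have hr₀ : r ≠ 0 := by linarith
  have hr₁ : r - 1 ≠ 0 := by linarith
  have hsplit : h ^ ((r - 1) / r) * h ^ (1 / r) = h := by
    rw [← Real.rpow_add hpos, ← add_div, sub_add_cancel, div_self hr₀, Real.rpow_one]
  have hroot : h ^ ((r - 1) / r) ≤ 2 * c := by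
    refine le_of_mul_le_mul_right ?_ (Real.rpow_pos_of_pos hpos (1 / r))
    linarith
  calc h = (h ^ ((r - 1) / r)) ^ (r / (r - 1)) := by
        rw [← Real.rpow_mul hh, div_mul_div_cancel₀ hr₀, div_self hr₁, Real.rpow_one]
    _ ≤ (2 * c) ^ (r / (r - 1)) :=
        Real.rpow_le_rpow (by positivity) hroot (div_nonneg (by linarith) (by linarith))

/-- One step of AGM-BiO decreases the weighted potential, up to the error of the cutting plane. -/
lemma bilevel_potential_step_le {E : Type*} [NormedAddCommGroup E] [InnerProductSpace ℝ E]
    [CompleteSpace E] {f g : E → ℝ} {f' g' : E → E} {Z : Set E} {L_f L_g l A a c : ℝ}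
    {x z z₁ y x₁ w : E}
    (hZ : Convex ℝ Z) (hfconv : ConvexOn ℝ Set.univ f) (hgconv : ConvexOn ℝ Set.univ g)
    (hf' : ∀ u, HasGradientAt f (f' u) u) (hg' : ∀ u, HasGradientAt g (g' u) u)
    (hLipf : ∀ u v, ‖f' u - f' v‖ ≤ L_f * ‖u - v‖)
    (hLipg : ∀ u v, ‖g' u - g' v‖ ≤ L_g * ‖u - v‖)
    (hl : 0 ≤ l) (hA : 0 ≤ A) (ha : 0 < a) (hstep : (l * L_f + L_g) * a ^ 2 / (A + a) ≤ l)
    (hw : w ∈ Z) (hc : g w ≤ c)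
    (hy : y = (A / (A + a)) • x + (a / (A + a)) • z)
    (hz₁ : z₁ ∈ Z ∧ g y + ⟪g' y, z₁ - y⟫ ≤ c)
    (hproj : ∀ u ∈ Z, g y + ⟪g' y, u - y⟫ ≤ c →
        ‖z₁ - (z - a • f' y)‖ ≤ ‖u - (z - a • f' y)‖)
    (hx₁ : x₁ = (A / (A + a)) • x + (a / (A + a)) • z₁) :
    (A + a) * (l * (f x₁ - f w) + (g x₁ - g w)) + l / 2 * ‖z₁ - w‖ ^ 2 ≤
      A * (l * (f x - f w) + (g x - g w)) + l / 2 * ‖z - w‖ ^ 2 + a * (c - g w) := by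
  have hK : Convex ℝ {u ∈ Z | g y + ⟪g' y, u - y⟫ ≤ c} := by
    rintro p ⟨hpZ, hp⟩ q ⟨hqZ, hq⟩ s t hs ht hst
    refine ⟨hZ hpZ hqZ hs ht hst, ?_⟩
    have hcomb : s • p + t • q - y = s • (p - y) + t • (q - y) := by
      rw [smul_sub, smul_sub, sub_add_sub_comm, ← add_smul, hst, one_smul]
    rw [hcomb, inner_add_right, real_inner_smul_right, real_inner_smul_right]
    have hp' := mul_le_mul_of_nonneg_left hp hs
    have hq' := mul_le_mul_of_nonneg_left hq ht
    obtain rfl : t = 1 - s := by linarith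
    linarith
  have hprox := two_mul_inner_le_of_projection hK hz₁ (fun u hu => hproj u hu.1 hu.2)
    ⟨hw, (hgconv.add_inner_gradient_le (hg' y) w).trans hc⟩
  have hfstep := mul_le_mul_of_nonneg_left
    (accelerated_step_le hfconv hf' hLipf hA ha hy hx₁) hl
  have hgstep := accelerated_step_le hgconv hg' hLipg hA ha hy hx₁
  have hfgrad := mul_le_mul_of_nonneg_left (hfconv.add_inner_gradient_le (hf' y) w)
    (mul_nonneg hl ha.le)
  have hcut := mul_le_mul_of_nonneg_left hz₁.2 ha.le
  have hinner : ⟪f' y, z₁ - w⟫ = ⟪f' y, z₁ - y⟫ - ⟪f' y, w - y⟫ := by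
    rw [← inner_sub_right, sub_sub_sub_cancel_right]
  have hprox' := mul_le_mul_of_nonneg_left hprox (div_nonneg hl zero_le_two)
  rw [hinner] at hprox'
  have hquad : l * (L_f * a ^ 2 / (2 * (A + a)) * ‖z₁ - z‖ ^ 2) +
      L_g * a ^ 2 / (2 * (A + a)) * ‖z₁ - z‖ ^ 2 ≤ l / 2 * ‖z₁ - z‖ ^ 2 := by
    have hpos : 0 < A + a := by positivity
    calc _ = (l * L_f + L_g) * a ^ 2 / (A + a) / 2 * ‖z₁ - z‖ ^ 2 := by field_simp
      _ ≤ l / 2 * ‖z₁ - z‖ ^ 2 := by gcongr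
  linarith

theorem agm_bio_heb_infeasibility
    {n : ℕ} {f g : EuclideanSpace ℝ (Fin n) → ℝ}
    {f' g' : EuclideanSpace ℝ (Fin n) → EuclideanSpace ℝ (Fin n)}
    {Z : Set (EuclideanSpace ℝ (Fin n))}
    {L_f L_g : ℝ} (hLf : 0 < L_f) (hLg : 0 < L_g)
    (hZconv : Convex ℝ Z) (hZcl : IsClosed Z)
    (hfconv : ConvexOn ℝ Set.univ f) (hgconv : ConvexOn ℝ Set.univ g)
    (hf' : ∀ w, HasGradientAt f (f' w) w)
    (hg' : ∀ w, HasGradientAt g (g' w) w)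
    (hLipf : ∀ u v, ‖f' u - f' v‖ ≤ L_f * ‖u - v‖)
    (hLipg : ∀ u v, ‖g' u - g' v‖ ≤ L_g * ‖u - v‖)
    {xstar : EuclideanSpace ℝ (Fin n)}
    (hxZ : xstar ∈ Z)
    (hxlow : ∀ w ∈ Z, g xstar ≤ g w)
    (hxopt : ∀ w ∈ Z, (∀ u ∈ Z, g w ≤ g u) → f xstar ≤ f w)
    {α r : ℝ} (hα : 0 < α) (hr : 1 < r)
    (hHEB : ∀ w ∈ Z, α / r * Metric.infDist w {w ∈ Z | ∀ u ∈ Z, g w ≤ g u} ^ r ≤ g w - g xstar)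
    {M : ℝ} (hM : IsGreatest ((fun w => ‖f' w‖) '' {w ∈ Z | ∀ u ∈ Z, g w ≤ g u}) M)
    {T : ℕ} (hT : 1 ≤ T) {γ : ℝ}
    (hγ : γ = 1 / (2 * L_g / L_f * (T : ℝ) ^ ((2 * r - 2) / (2 * r - 1)) + 2))
    {x z y : ℕ → EuclideanSpace ℝ (Fin n)} {A a gs : ℕ → ℝ}
    (hA0 : A 0 = 0) (hxz0 : x 0 = z 0)
    (ha : ∀ k : ℕ, a k = γ * ((k : ℝ) + 1) / (4 * L_f))
    (hArec : ∀ k, A (k + 1) = A k + a k)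
    (hy : ∀ k, y k = (A k / (A k + a k)) • x k + (a k / (A k + a k)) • z k)
    (hgs : ∀ k : ℕ, 0 ≤ gs k - g xstar ∧
        gs k - g xstar ≤ 2 * L_g * ‖x 0 - xstar‖ ^ 2 / ((k : ℝ) + 1) ^ 2)
    (hzmem : ∀ k, z (k + 1) ∈ Z ∧ g (y k) + ⟪g' (y k), z (k + 1) - y k⟫ ≤ gs k)
    (hzproj : ∀ k, ∀ w ∈ Z, g (y k) + ⟪g' (y k), w - y k⟫ ≤ gs k →
        ‖z (k + 1) - (z k - a k • f' (y k))‖ ≤ ‖w - (z k - a k • f' (y k))‖)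
    (hxrec : ∀ k, x (k + 1) = (A k / (A k + a k)) • x k + (a k / (A k + a k)) • z (k + 1)) :
    g (x T) - g xstar ≤
      max (2 * (12 * L_g * ‖x 0 - xstar‖ ^ 2) * (Real.log (T : ℝ) + 1) / (T : ℝ) ^ (2 * r / (2 * r - 1)) +
            2 * (8 * L_f * ‖x 0 - xstar‖ ^ 2) / (T : ℝ) ^ 2)
        ((2 * (M * (r / α) ^ (1 / r))) ^ (r / (r - 1)) / (T : ℝ) ^ (2 * r / (2 * r - 1))) := by
  set S := {w ∈ Z | ∀ u ∈ Z, g w ≤ g u}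
  have hTpos : (0 : ℝ) < T := by exact_mod_cast hT
  have hT1 : (1 : ℝ) ≤ T := by exact_mod_cast hT
  have hlog : 0 ≤ Real.log T := Real.log_nonneg hT1
  have hden : 0 < 2 * r - 1 := by linarith
  obtain ⟨l, hl⟩ : ∃ l, l = (T : ℝ) ^ (-((2 * r - 2) / (2 * r - 1))) := ⟨_, rfl⟩
  have hlpos : 0 < l := hl ▸ Real.rpow_pos_of_pos hTpos _
  have hTl : (T : ℝ) ^ ((2 * r - 2) / (2 * r - 1)) = l⁻¹ := by
    rw [hl, Real.rpow_neg hTpos.le, inv_inv]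
  have hγpos : 0 < γ := by rw [hγ]; positivity
  have hγl : γ * (l * L_f + L_g) = l * L_f / 2 := by
    rw [hγ, hTl]
    field_simp
    ring
  have hapos : ∀ k, 0 < a k := fun k => by rw [ha]; positivity
  have hA : ∀ k : ℕ, A k = γ * (k * (k + 1)) / (8 * L_f) := by
    intro k
    induction k with
    | zero => simp [hA0]
    | succ k ih =>
      rw [hArec, ih, ha]
      push_cast
      field_simp
      ring
  have hstep : ∀ k, (l * L_f + L_g) * a k ^ 2 / (A k + a k) ≤ l := by
    intro k
    have hAa : A k + a k = γ * ((k + 1) * (k + 2)) / (8 * L_f) := by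
      rw [← hArec, hA]; push_cast; ring
    calc (l * L_f + L_g) * a k ^ 2 / (A k + a k)
        = γ * (l * L_f + L_g) * (k + 1) / (2 * L_f * (k + 2)) := by
          rw [hAa, ha]; field_simp; norm_num
      _ = l * ((k + 1) / (4 * (k + 2))) := by rw [hγl]; field_simp; norm_num
      _ ≤ l * 1 := by
          gcongr
          rw [div_le_one (by positivity)]
          linarith [(Nat.cast_nonneg k : (0 : ℝ) ≤ k)]
      _ = l := mul_one l
  have hpotential : ∀ k, A k * (l * (f (x k) - f xstar) + (g (x k) - g xstar)) +
      l / 2 * ‖z k - xstar‖ ^ 2 ≤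
        l / 2 * ‖x 0 - xstar‖ ^ 2 + ∑ i ∈ Finset.range k, a i * (gs i - g xstar) := by
    intro k
    induction k with
    | zero => simp [hA0, hxz0]
    | succ k ih =>
      have h := bilevel_potential_step_le hZconv hfconv hgconv hf' hg' hLipf hLipg hlpos.le
        (by rw [hA]; positivity) (hapos k) (hstep k) hxZ (sub_nonneg.1 (hgs k).1) (hy k)
        (hzmem k) (hzproj k) (hxrec k)
      rw [hArec, Finset.sum_range_succ]
      linarith
  have hsum : ∑ i ∈ Finset.range T, a i * (gs i - g xstar) ≤
      γ * L_g * ‖x 0 - xstar‖ ^ 2 / (2 * L_f) * (Real.log T + 1) := calc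
    _ ≤ ∑ i ∈ Finset.range T,
        γ * L_g * ‖x 0 - xstar‖ ^ 2 / (2 * L_f) * ((i : ℝ) + 1)⁻¹ := by
      refine Finset.sum_le_sum fun i _ => ?_
      refine (mul_le_mul_of_nonneg_left (hgs i).2 (hapos i).le).trans_eq ?_
      rw [ha]
      field_simp
      norm_num
    _ ≤ _ := by
      rw [← Finset.mul_sum]
      gcongr
      exact sum_range_inv_succ_le_log_add_one T
  have hweighted : l * (f (x T) - f xstar) + (g (x T) - g xstar) ≤
      (12 * L_g * ‖x 0 - xstar‖ ^ 2 * (Real.log T + 1) +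
        l * (8 * L_f * ‖x 0 - xstar‖ ^ 2)) / T ^ 2 := by
    have hAT : 0 < A T := by rw [hA]; positivity
    have hbound : A T * (l * (f (x T) - f xstar) + (g (x T) - g xstar)) ≤
        γ * T ^ 2 / (8 * L_f) * ((12 * L_g * ‖x 0 - xstar‖ ^ 2 * (Real.log T + 1) +
          l * (8 * L_f * ‖x 0 - xstar‖ ^ 2)) / T ^ 2) := by
      have hrhs : γ * T ^ 2 / (8 * L_f) * ((12 * L_g * ‖x 0 - xstar‖ ^ 2 * (Real.log T + 1) +
          l * (8 * L_f * ‖x 0 - xstar‖ ^ 2)) / T ^ 2) =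
          γ * L_g * ‖x 0 - xstar‖ ^ 2 / (2 * L_f) * (Real.log T + 1) +
          γ * L_g * ‖x 0 - xstar‖ ^ 2 / L_f * Real.log T +
          γ * (l * L_f + L_g) * ‖x 0 - xstar‖ ^ 2 / L_f := by
        field_simp
        ring
      have hlast : γ * (l * L_f + L_g) * ‖x 0 - xstar‖ ^ 2 / L_f =
          l / 2 * ‖x 0 - xstar‖ ^ 2 := by
        rw [hγl]; field_simp
      have hmid : 0 ≤ γ * L_g * ‖x 0 - xstar‖ ^ 2 / L_f * Real.log T := by positivity
      have hdist : 0 ≤ l / 2 * ‖z T - xstar‖ ^ 2 := by positivity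
      rw [hrhs, hlast]
      linarith [hpotential T]
    refine le_of_mul_le_mul_left (hbound.trans ?_) hAT
    gcongr
    rw [hA]
    gcongr
    nlinarith
  have hxmem : ∀ k, x (k + 1) ∈ Z := by
    intro k
    induction k with
    | zero => simpa [hxrec 0, hA0, div_self (hapos 0).ne'] using (hzmem 0).1
    | succ k ih =>
      have hAk : 0 ≤ A (k + 1) := by rw [hA]; positivity
      have hak := hapos (k + 1)
      rw [hxrec]
      refine hZconv ih (hzmem _).1 (by positivity) (by positivity) ?_
      rw [← add_div, div_self (by positivity)]
  have hxT : x T ∈ Z := by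
    obtain ⟨k, rfl⟩ := Nat.exists_eq_add_of_le' hT
    exact hxmem k
  have hh : 0 ≤ g (x T) - g xstar := sub_nonneg.2 (hxlow _ hxT)
  have hxS : xstar ∈ S := ⟨hxZ, hxlow⟩
  have hScl : IsClosed S := by
    have hgcont : Continuous g :=
      continuous_iff_continuousAt.2 fun w => (hg' w).hasFDerivAt.continuousAt
    have hSeq : S = Z ∩ {w | g w ≤ g xstar} := by
      ext w
      exact ⟨fun hw => ⟨hw.1, hw.2 _ hxZ⟩, fun hw => ⟨hw.1, fun u hu => hw.2.trans (hxlow u hu)⟩⟩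
    rw [hSeq]
    exact hZcl.inter (isClosed_le hgcont continuous_const)
  have hMub : ∀ w ∈ S, ‖f' w‖ ≤ M := fun w hw => hM.2 ⟨w, hw, rfl⟩
  have hMnonneg : 0 ≤ M := (norm_nonneg _).trans (hMub xstar hxS)
  have hlower := hfconv.sub_mul_infDist_le hf' hScl ⟨xstar, hxS⟩
    (fun w hw => hxopt w hw.1 hw.2) hMub (x T)
  have hrpos : 0 < r := by linarith
  have hdist : Metric.infDist (x T) S ≤ (r / α) ^ (1 / r) * (g (x T) - g xstar) ^ (1 / r) := by
    rw [← Real.mul_rpow (by positivity) hh, one_div,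
      Real.le_rpow_inv_iff_of_pos Metric.infDist_nonneg (by positivity) hrpos]
    calc Metric.infDist (x T) S ^ r = r / α * (α / r * Metric.infDist (x T) S ^ r) := by
          field_simp
      _ ≤ r / α * (g (x T) - g xstar) := by gcongr; exact hHEB _ hxT
  set C := M * (r / α) ^ (1 / r) with hC
  have hCnonneg : 0 ≤ C := by positivity
  have hself : g (x T) - g xstar ≤ l * C * (g (x T) - g xstar) ^ (1 / r) +
      (12 * L_g * ‖x 0 - xstar‖ ^ 2 * (Real.log T + 1) +
        l * (8 * L_f * ‖x 0 - xstar‖ ^ 2)) / T ^ 2 := by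
    have h₁ := mul_le_mul_of_nonneg_left hdist (mul_nonneg hlpos.le hMnonneg)
    have h₂ := mul_le_mul_of_nonneg_left hlower hlpos.le
    rw [hC]
    linarith
  refine (le_max_two_mul_rpow_of_le_mul_rpow_add hh (by positivity) hr hself).trans
    (max_le_max ?_ (le_of_eq ?_))
  · have hl1 : l ≤ 1 := by
      rw [hl]
      exact Real.rpow_le_one_of_one_le_of_nonpos hT1
        (neg_nonpos.2 (div_nonneg (by linarith) hden.le))
    have hpow : (T : ℝ) ^ (2 * r / (2 * r - 1)) ≤ (T : ℝ) ^ 2 := by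
      rw [← Real.rpow_two]
      refine Real.rpow_le_rpow_of_exponent_le hT1 ?_
      rw [div_le_iff₀ hden]
      linarith
    calc _ = 2 * (12 * L_g * ‖x 0 - xstar‖ ^ 2) * (Real.log T + 1) / T ^ 2 +
          l * (2 * (8 * L_f * ‖x 0 - xstar‖ ^ 2)) / T ^ 2 := by ring
      _ ≤ 2 * (12 * L_g * ‖x 0 - xstar‖ ^ 2) * (Real.log T + 1) / T ^ (2 * r / (2 * r - 1)) +
          1 * (2 * (8 * L_f * ‖x 0 - xstar‖ ^ 2)) / T ^ 2 := by gcongr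
      _ = _ := by ring
  · have hr₁ : r - 1 ≠ 0 := by linarith
    rw [show 2 * (l * C) = 2 * C * l by ring, Real.mul_rpow (by positivity) hlpos.le, hl,
      ← Real.rpow_mul hTpos.le,
      show -((2 * r - 2) / (2 * r - 1)) * (r / (r - 1)) = -(2 * r / (2 * r - 1)) by
        field_simp,
      Real.rpow_neg hTpos.le, ← div_eq_mul_inv]
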